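/- arXiv:2510.00409 — 10 statements merged into one kernel-verified Lean document; each statement's English description precedes it below -/
import Mathlib

section
/- Let (F_n) be a sequential IFS with ratio λ on ℝ^q, with limit IFS F. For each n let A_n be the attractor of F_n and let A be the attractor of F. Then A_n converges to A in the Hausdorff metric, i.e. the Hausdorff distance between A_n and A tends to 0 as n → ∞. -/
open Filter Metric Topology

/-- Continuity estimate for attractors: if two families of maps are uniformly `δ`-close and the
second one consists of `K`-Lipschitz maps, then compact invariant sets `S`, `T` of the two families
satisfy `(1 - K) * hausdorffDist S T ≤ δ`. -/
theorem one_sub_mul_hausdorffDist_le_of_dist_le {ι X : Type*} [PseudoMetricSpace X]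
    {K : NNReal} {f g : ι → X → X} {S T : Set X} {δ : ℝ}
    (hg : ∀ i, LipschitzWith K (g i)) (hfg : ∀ i x, dist (f i x) (g i x) ≤ δ) (hδ : 0 ≤ δ)
    (hS : S.Nonempty) (hSc : IsCompact S) (hSf : S = ⋃ i, f i '' S)
    (hT : T.Nonempty) (hTc : IsCompact T) (hTg : T = ⋃ i, g i '' T) :
    (1 - K) * hausdorffDist S T ≤ δ := by
  have hfin : hausdorffEDist S T ≠ ⊤ :=
    hausdorffEDist_ne_top_of_nonempty_of_bounded hS hT hSc.isBounded hTc.isBounded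
  have key : ∀ i s t, dist s t ≤ hausdorffDist S T →
      dist (f i s) (g i t) ≤ δ + K * hausdorffDist S T := fun i s t hst =>
    calc dist (f i s) (g i t) ≤ dist (f i s) (g i s) + dist (g i s) (g i t) :=
          dist_triangle _ _ _
      _ ≤ δ + K * hausdorffDist S T := by
          gcongr
          · exact hfg i s
          · exact ((hg i).dist_le_mul s t).trans (by gcongr)
  have hle : hausdorffDist S T ≤ δ + K * hausdorffDist S T := by
    refine hausdorffDist_le_of_mem_dist
      (add_nonneg hδ (mul_nonneg K.coe_nonneg hausdorffDist_nonneg)) ?_ ?_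
    · intro x hx
      rw [hSf] at hx
      obtain ⟨i, s, hs, rfl⟩ := Set.mem_iUnion.1 hx
      obtain ⟨t, ht, hst⟩ := hTc.exists_infDist_eq_dist hT s
      refine ⟨g i t, ?_, key i s t (hst ▸ infDist_le_hausdorffDist_of_mem hs hfin)⟩
      rw [hTg]
      exact Set.mem_iUnion.2 ⟨i, t, ht, rfl⟩
    · intro y hy
      rw [hTg] at hy
      obtain ⟨i, t, ht, rfl⟩ := Set.mem_iUnion.1 hy
      obtain ⟨s, hs, hts⟩ := hSc.exists_infDist_eq_dist hS t
      refine ⟨f i s, ?_, ?_⟩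
      · rw [hSf]
        exact Set.mem_iUnion.2 ⟨i, s, hs, rfl⟩
      · rw [dist_comm]
        refine key i s t ?_
        rw [dist_comm, ← hts, hausdorffDist_comm]
        exact infDist_le_hausdorffDist_of_mem ht (by rwa [hausdorffEDist_comm])
  linarith

/-- Let `(F n)` be a sequential IFS with ratio `λ` on `ℝ^q`, with limit
IFS `F`. For each `n` let `A n` be the attractor of `F n` and let `A` be the attractor of
`F`. Then `A n` converges to `A` in the Hausdorff metric. -/
theorem sifs_attractor_convergence
    (q M : ℕ) (hq : 1 ≤ q) (hM : 1 ≤ M)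
    (lam : NNReal) (hlam0 : 0 < lam) (hlam1 : lam < 1)
    (f : ℕ → Fin M → EuclideanSpace ℝ (Fin q) → EuclideanSpace ℝ (Fin q))
    (flim : Fin M → EuclideanSpace ℝ (Fin q) → EuclideanSpace ℝ (Fin q))
    (hLip : ∀ n i, LipschitzWith lam (f n i))
    (hLipLim : ∀ i, LipschitzWith lam (flim i))
    (hconv : ∀ i, TendstoUniformly (fun n => f n i) (flim i) atTop)
    (A : ℕ → Set (EuclideanSpace ℝ (Fin q)))
    (hAne : ∀ n, (A n).Nonempty) (hAcp : ∀ n, IsCompact (A n))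
    (hAattr : ∀ n, A n = ⋃ i, f n i '' A n)
    (Alim : Set (EuclideanSpace ℝ (Fin q)))
    (hAlimne : Alim.Nonempty) (hAlimcp : IsCompact Alim)
    (hAlimattr : Alim = ⋃ i, flim i '' Alim) :
    Tendsto (fun n => hausdorffDist (A n) Alim) atTop (𝓝 0) := by
  have hpos : (0 : ℝ) < 1 - lam := sub_pos.2 (by exact_mod_cast hlam1)
  rw [Metric.tendsto_atTop']
  intro ε hε
  have hδ : 0 < (1 - lam) * (ε / 2) := by positivity
  have hclose : ∀ᶠ n in atTop, ∀ i x, dist (flim i x) (f n i x) < (1 - lam) * (ε / 2) :=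
    eventually_all.2 fun i => Metric.tendstoUniformly_iff.1 (hconv i) _ hδ
  obtain ⟨N, hN⟩ := eventually_atTop.1 hclose
  refine ⟨N, fun n hn => ?_⟩
  have h := one_sub_mul_hausdorffDist_le_of_dist_le hLipLim
    (fun i x => (dist_comm _ _).trans_le (hN n hn.le i x).le) hδ.le
    (hAne n) (hAcp n) (hAattr n) hAlimne hAlimcp hAlimattr
  rw [Real.dist_0_eq_abs, abs_of_nonneg hausdorffDist_nonneg]
  linarith [le_of_mul_le_mul_left h hpos]
end

section
/- Let ((F_n), (K_i)) be an SIFS system with ratio λ on ℝ^q, with limit IFS F, and let A be the attractor of F. Then ∪S_k converges to A in the Hausdorff metric as k → ∞, i.e. the Hausdorff distance between ∪S_k and A tends to 0. -/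
open Filter Metric Topology

/-- The depth-`k` composition `f^{(k)}_{w 0} ∘ f^{(k-1)}_{w 1} ∘ ⋯ ∘ f^{(1)}_{w (k-1)}`
of an SIFS `f` along a word `w` of length `k`. -/
def sifsMap {E : Type*} {M : ℕ} (f : ℕ → Fin M → E → E) :
    (k : ℕ) → (Fin k → Fin M) → E → E
  | 0, _ => id
  | k + 1, w => f (k + 1) (w 0) ∘ sifsMap f k (fun t => w t.succ)

/-- The depth-`(k+1)` tile `π_T(j₁ … j_{k+1}) = (f^{(k+1)}_{j₁} ∘ ⋯ ∘ f^{(1)}_{j_{k+1}})(K_{j_{k+1}})`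
of an SIFS system, for a word `w` of length `k+1`. -/
def piT {E : Type*} {M : ℕ} (f : ℕ → Fin M → E → E) (K : Fin M → Set E)
    (k : ℕ) (w : Fin (k + 1) → Fin M) : Set E :=
  sifsMap f (k + 1) w '' K (w (Fin.last k))

/-- The support `∪S_k` of the `k`-th collection; `∪S_0 = ⋃ i, K i`. -/
def unionS {E : Type*} {M : ℕ} (f : ℕ → Fin M → E → E) (K : Fin M → Set E) :
    ℕ → Set E
  | 0 => ⋃ i, K i
  | k + 1 => ⋃ w : Fin (k + 1) → Fin M, piT f K k w

theorem unionS_add_two {E : Type*} {M : ℕ} (f : ℕ → Fin M → E → E) (K : Fin M → Set E) (k : ℕ) :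
    unionS f K (k + 2) = ⋃ i, f (k + 2) i '' unionS f K (k + 1) := by
  ext x
  simp only [unionS, piT, Set.mem_iUnion, Set.mem_image]
  constructor
  · rintro ⟨w, y, hy, rfl⟩
    exact ⟨w 0, _, ⟨fun t => w t.succ, y, hy, rfl⟩, rfl⟩
  · rintro ⟨i, _, ⟨w, y, hy, rfl⟩, rfl⟩
    exact ⟨Fin.cons i w, y, by simpa [← Fin.succ_last] using hy, rfl⟩

theorem unionS_one {E : Type*} {M : ℕ} (f : ℕ → Fin M → E → E) (K : Fin M → Set E) :
    unionS f K 1 = ⋃ w : Fin 1 → Fin M, f 1 (w 0) '' K (w 0) := rfl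

theorem isCompact_unionS_succ {E : Type*} [TopologicalSpace E] {M : ℕ} {f : ℕ → Fin M → E → E}
    {K : Fin M → Set E} (hf : ∀ n i, Continuous (f n i)) (hK : ∀ i, IsCompact (K i)) (k : ℕ) :
    IsCompact (unionS f K (k + 1)) := by
  induction k with
  | zero =>
    rw [unionS_one]
    exact isCompact_iUnion fun w => (hK _).image (hf _ _)
  | succ k ih =>
    rw [unionS_add_two]
    exact isCompact_iUnion fun i => ih.image (hf _ _)

theorem nonempty_unionS_succ {E : Type*} {M : ℕ} [Nonempty (Fin M)] (f : ℕ → Fin M → E → E)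
    {K : Fin M → Set E} (hK : ∀ i, (K i).Nonempty) (k : ℕ) : (unionS f K (k + 1)).Nonempty :=
  Set.nonempty_iUnion.2 ⟨fun _ => Classical.arbitrary _, (hK _).image _⟩

/-- The Hutchinson operators of two pointwise `ε`-close families of contractions change the
Hausdorff distance by at most the contraction ratio, up to an error `ε`. -/
theorem hausdorffDist_iUnion_image_le {ι E : Type*} [MetricSpace E] {c : NNReal} {ε : ℝ}
    (hε : 0 ≤ ε) {f g : ι → E → E} (hf : ∀ i, LipschitzWith c (f i))
    (hfg : ∀ i x, dist (f i x) (g i x) ≤ ε) {S A : Set E}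
    (hS : IsCompact S) (hS₀ : S.Nonempty) (hA : IsCompact A) (hA₀ : A.Nonempty) :
    hausdorffDist (⋃ i, f i '' S) (⋃ i, g i '' A) ≤ c * hausdorffDist S A + ε := by
  have hfin := hausdorffEDist_ne_top_of_nonempty_of_bounded hS₀ hA₀ hS.isBounded hA.isBounded
  have key : ∀ i x y, dist x y ≤ hausdorffDist S A →
      dist (f i x) (g i y) ≤ c * hausdorffDist S A + ε := fun i x y hxy =>
    calc dist (f i x) (g i y) ≤ dist (f i x) (f i y) + dist (f i y) (g i y) :=
          dist_triangle _ _ _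
      _ ≤ c * hausdorffDist S A + ε :=
          add_le_add ((hf i).dist_le_mul_of_le hxy) (hfg i y)
  refine hausdorffDist_le_of_mem_dist
    (add_nonneg (mul_nonneg c.2 hausdorffDist_nonneg) hε) ?_ ?_
  · rintro _ hx
    obtain ⟨i, x, hxS, rfl⟩ := Set.mem_iUnion.1 hx
    obtain ⟨y, hy, hxy⟩ := hA.exists_infDist_eq_dist hA₀ x
    exact ⟨g i y, Set.mem_iUnion.2 ⟨i, y, hy, rfl⟩,
      key i x y (hxy ▸ infDist_le_hausdorffDist_of_mem hxS hfin)⟩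
  · rintro _ hy
    obtain ⟨i, y, hyA, rfl⟩ := Set.mem_iUnion.1 hy
    obtain ⟨x, hx, hyx⟩ := hS.exists_infDist_eq_dist hS₀ y
    refine ⟨f i x, Set.mem_iUnion.2 ⟨i, x, hx, rfl⟩, ?_⟩
    rw [dist_comm]
    refine key i x y ?_
    rw [dist_comm, ← hyx, hausdorffDist_comm]
    exact infDist_le_hausdorffDist_of_mem hyA (by rwa [hausdorffEDist_comm])

theorem tendsto_zero_of_eventually_succ_le_mul_add {d : ℕ → ℝ} {c : ℝ} (hd : ∀ n, 0 ≤ d n)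
    (hc₀ : 0 ≤ c) (hc₁ : c < 1) (h : ∀ ε > 0, ∀ᶠ n in atTop, d (n + 1) ≤ c * d n + ε) :
    Tendsto d atTop (𝓝 0) := by
  refine tendsto_order.2 ⟨fun a ha => .of_forall fun n => ha.trans_le (hd n), fun ε hε => ?_⟩
  obtain ⟨N, hN⟩ := eventually_atTop.1
    (h ((1 - c) * (ε / 2)) (mul_pos (sub_pos.2 hc₁) (half_pos hε)))
  have hbound : ∀ n, d (n + N) ≤ c ^ n * d N + ε / 2 := by
    intro n
    induction n with
    | zero => simpa using (half_pos hε).le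
    | succ n ih =>
      have h₁ := hN (n + N) (Nat.le_add_left _ _)
      have h₂ := mul_le_mul_of_nonneg_left ih hc₀
      rw [Nat.add_right_comm, pow_succ]
      linarith
  have hpow : Tendsto (fun n => c ^ n * d N) atTop (𝓝 0) := by
    simpa using (tendsto_pow_atTop_nhds_zero_of_lt_one hc₀ hc₁).mul_const (d N)
  rw [← map_add_atTop_eq_nat N, eventually_map]
  filter_upwards [hpow.eventually_lt_const (half_pos hε)] with n hn
  linarith [hbound n]

/-- For an SIFS system `((F n), (K i))` with ratio `λ` and limit IFS `F`
with attractor `A`, the supports `∪S_k` converge to `A` in the Hausdorff metric. -/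
theorem sifs_system_support_convergence
    (q M : ℕ) (hq : 1 ≤ q) (hM : 1 ≤ M)
    (lam : NNReal) (hlam0 : 0 < lam) (hlam1 : lam < 1)
    (f : ℕ → Fin M → EuclideanSpace ℝ (Fin q) → EuclideanSpace ℝ (Fin q))
    (flim : Fin M → EuclideanSpace ℝ (Fin q) → EuclideanSpace ℝ (Fin q))
    (hLip : ∀ n i, LipschitzWith lam (f n i))
    (hLipLim : ∀ i, LipschitzWith lam (flim i))
    (hconv : ∀ i, TendstoUniformly (fun n => f n i) (flim i) atTop)
    (K : Fin M → Set (EuclideanSpace ℝ (Fin q)))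
    (hKne : ∀ i, (K i).Nonempty) (hKcp : ∀ i, IsCompact (K i))
    (Alim : Set (EuclideanSpace ℝ (Fin q)))
    (hAlimne : Alim.Nonempty) (hAlimcp : IsCompact Alim)
    (hAlimattr : Alim = ⋃ i, flim i '' Alim) :
    Tendsto (fun k => hausdorffDist (unionS f K k) Alim) atTop (𝓝 0) := by
  have : Nonempty (Fin M) := ⟨⟨0, hM⟩⟩
  rw [← tendsto_add_atTop_iff_nat 1]
  refine tendsto_zero_of_eventually_succ_le_mul_add (c := lam) (fun _ => hausdorffDist_nonneg)
    lam.2 hlam1 fun ε hε => ?_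
  have hclose : ∀ᶠ n in atTop, ∀ i x, dist (flim i x) (f n i x) < ε :=
    eventually_all.2 fun i => Metric.tendstoUniformly_iff.1 (hconv i) ε hε
  filter_upwards [(tendsto_add_atTop_nat 2).eventually hclose] with k hk
  have hstep := hausdorffDist_iUnion_image_le hε.le (hLip (k + 2))
    (fun i x => (dist_comm (f (k + 2) i x) (flim i x)).trans_le (hk i x).le)
    (isCompact_unionS_succ (fun n i => (hLip n i).continuous) hKcp k)
    (nonempty_unionS_succ f hKne k) hAlimcp hAlimne
  rwa [← unionS_add_two, ← hAlimattr] at hstep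
end

section
/- Let ((F_n), (K_i)) be an SIFS system with ratio λ on ℝ^q, with limit IFS F. Fix an infinite address j = j_1 j_2 j_3 ⋯ ∈ {1,…,M}^ℕ, a point x₀ ∈ ℝ^q, and a point p ∈ ℝ^q with (f_{j_1} ∘ ⋯ ∘ f_{j_m})(x₀) → p as m → ∞ (p is the point of the attractor with address j). Then the depth-n tiles along j converge to the singleton {p}: the Hausdorff distance between π_T(j_1 j_2 … j_n) and {p} tends to 0 as n → ∞. -/
open Filter Metric Topology

/-- The composition `f_{j₁} ∘ ⋯ ∘ f_{j_m}` of the first `m` maps of the limit IFS along an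
infinite address `j : ℕ → Fin M` (with `j 0 = j₁`). -/
def prefixComp {E : Type*} {M : ℕ} (h : Fin M → E → E) (j : ℕ → Fin M) : ℕ → E → E
  | 0 => id
  | m + 1 => prefixComp h j m ∘ h (j m)

/-- Splitting off the outermost map of a prefix composition. -/
lemma prefixComp_succ' {E : Type*} {M : ℕ} (h : Fin M → E → E) (j : ℕ → Fin M) (m : ℕ) :
    prefixComp h j (m + 1) = h (j 0) ∘ prefixComp h (fun t => j (t + 1)) m := by
  induction m with
  | zero => rfl
  | succ m ih =>
    rw [prefixComp, ih]
    rfl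

section

variable {E : Type*} [PseudoMetricSpace E] {M : ℕ} {lam : NNReal}

/-- A ball that every map of the SIFS sends into itself is preserved by all compositions. -/
lemma dist_sifsMap_le {f : ℕ → Fin M → E → E} (hLip : ∀ n i, LipschitzWith lam (f n i))
    {x₀ : E} {D B : ℝ} (hD : ∀ n i, dist (f n i x₀) x₀ ≤ D) (hB : lam * B + D ≤ B)
    (k : ℕ) (w : Fin k → Fin M) {y : E} (hy : dist y x₀ ≤ B) :
    dist (sifsMap f k w y) x₀ ≤ B := by
  induction k with
  | zero => exact hy
  | succ k ih =>
    set z := sifsMap f k (fun t => w t.succ) y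
    have hz : dist z x₀ ≤ B := ih _
    calc dist (f (k + 1) (w 0) z) x₀
        ≤ dist (f (k + 1) (w 0) z) (f (k + 1) (w 0) x₀) + dist (f (k + 1) (w 0) x₀) x₀ :=
          dist_triangle _ _ _
      _ ≤ lam * dist z x₀ + D := add_le_add ((hLip _ _).dist_le_mul _ _) (hD _ _)
      _ ≤ lam * B + D := by gcongr
      _ ≤ B := hB

/-- If the maps of depth larger than `k` are `η`-close to the limit IFS, then the composition
of depth `k + m` is close to the composition of the first `m` maps of the limit IFS. -/
lemma dist_sifsMap_prefixComp_le {f : ℕ → Fin M → E → E} {flim : Fin M → E → E}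
    (hLip : ∀ n i, LipschitzWith lam (f n i)) {x₀ y : E} {B η c : ℝ} {k : ℕ}
    (hbd : ∀ w : Fin k → Fin M, dist (sifsMap f k w y) x₀ ≤ B)
    (hη : ∀ n, k ≤ n → ∀ i x, dist (f n i x) (flim i x) ≤ η)
    (hc₀ : 0 ≤ c) (hc : lam * c + η ≤ c) (m : ℕ) (j : ℕ → Fin M) :
    dist (sifsMap f (k + m) (fun t => j t) y) (prefixComp flim j m x₀) ≤ lam ^ m * B + c := by
  induction m generalizing j with
  | zero => simpa [prefixComp] using (hbd fun t => j t).trans (le_add_of_nonneg_right hc₀)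
  | succ m ih =>
    rw [prefixComp_succ']
    set z := sifsMap f (k + m) (fun t => j (t + 1)) y
    set z' := prefixComp flim (fun t => j (t + 1)) m x₀
    have hz : dist z z' ≤ lam ^ m * B + c := ih fun t => j (t + 1)
    calc dist (f (k + m + 1) (j 0) z) (flim (j 0) z')
        ≤ dist (f (k + m + 1) (j 0) z) (f (k + m + 1) (j 0) z')
          + dist (f (k + m + 1) (j 0) z') (flim (j 0) z') := dist_triangle _ _ _
      _ ≤ lam * dist z z' + η :=
          add_le_add ((hLip _ _).dist_le_mul _ _) (hη _ (by lia) _ _)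
      _ ≤ lam * (lam ^ m * B + c) + η := by gcongr
      _ ≤ lam ^ (m + 1) * B + c := by linear_combination hc

/-- Pointwise convergence of finitely many sequences of maps bounds their displacements of a
point uniformly. -/
lemma exists_dist_le_of_tendsto {f : ℕ → Fin M → E → E} {flim : Fin M → E → E} {x₀ : E}
    (h : ∀ i, Tendsto (fun n => f n i x₀) atTop (𝓝 (flim i x₀))) :
    ∃ D, ∀ n i, dist (f n i x₀) x₀ ≤ D := by
  have hb : Bornology.IsBounded (⋃ i, Set.range fun n => f n i x₀) :=
    Bornology.isBounded_iUnion.2 fun i => isBounded_range_of_tendsto _ (h i)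
  obtain ⟨D, hD⟩ := hb.subset_closedBall x₀
  exact ⟨D, fun n i => hD (Set.mem_iUnion.2 ⟨i, n, rfl⟩)⟩

end

/-- For an SIFS system with limit IFS `F`, and an infinite address `j` whose
limit-IFS coding point is `p`, the depth-`n` tiles `π_T(j₁ … j_n)` converge to `{p}` in the
Hausdorff metric. -/
theorem sifs_system_tile_convergence
    (q M : ℕ) (hq : 1 ≤ q) (hM : 1 ≤ M)
    (lam : NNReal) (hlam0 : 0 < lam) (hlam1 : lam < 1)
    (f : ℕ → Fin M → EuclideanSpace ℝ (Fin q) → EuclideanSpace ℝ (Fin q))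
    (flim : Fin M → EuclideanSpace ℝ (Fin q) → EuclideanSpace ℝ (Fin q))
    (hLip : ∀ n i, LipschitzWith lam (f n i))
    (hLipLim : ∀ i, LipschitzWith lam (flim i))
    (hconv : ∀ i, TendstoUniformly (fun n => f n i) (flim i) atTop)
    (K : Fin M → Set (EuclideanSpace ℝ (Fin q)))
    (hKne : ∀ i, (K i).Nonempty) (hKcp : ∀ i, IsCompact (K i))
    (j : ℕ → Fin M) (x₀ p : EuclideanSpace ℝ (Fin q))
    (hp : Tendsto (fun m => prefixComp flim j m x₀) atTop (𝓝 p)) :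
    Tendsto (fun n => hausdorffDist (piT f K n (fun t : Fin (n + 1) => j t)) {p})
      atTop (𝓝 0) := by
  have hl : 0 < 1 - (lam : ℝ) := sub_pos.2 (by exact_mod_cast hlam1)
  obtain ⟨D, hD⟩ := exists_dist_le_of_tendsto fun i => (hconv i).tendsto_at x₀
  obtain ⟨R, hR⟩ := (Bornology.isBounded_iUnion.2 fun i => (hKcp i).isBounded).subset_closedBall x₀
  set B := max R (D / (1 - lam))
  have hB : lam * B + D ≤ B := by
    have := (div_le_iff₀ hl).1 (le_max_right R (D / (1 - lam)))
    linear_combination this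
  have hKB : ∀ i, ∀ y ∈ K i, dist y x₀ ≤ B := fun i y hy =>
    (hR (Set.mem_iUnion.2 ⟨i, hy⟩)).trans (le_max_left _ _)
  rw [Metric.tendsto_atTop]
  intro ε hε
  have hpow : Tendsto (fun m => (lam : ℝ) ^ m * B) atTop (𝓝 0) := by
    simpa using (tendsto_pow_atTop_nhds_zero_of_lt_one lam.coe_nonneg
      (by exact_mod_cast hlam1)).mul_const B
  obtain ⟨m, hm, hmp⟩ := ((hpow.eventually_lt_const (show 0 < ε / 4 by positivity)).and
    (Metric.tendsto_nhds.1 hp (ε / 4) (by positivity))).exists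
  obtain ⟨N, hN⟩ := eventually_atTop.1 (eventually_all.2 fun i =>
    Metric.tendstoUniformly_iff.1 (hconv i) ((1 - lam) * (ε / 4)) (by positivity))
  refine ⟨N + m, fun n hn => ?_⟩
  obtain ⟨k, hk⟩ : ∃ k, n + 1 = k + m := ⟨n + 1 - m, by lia⟩
  have hclose : ∀ y ∈ K (j n),
      dist (sifsMap f (n + 1) (fun t => j t) y) p ≤ 3 * (ε / 4) := by
    intro y hy
    have := dist_sifsMap_prefixComp_le (flim := flim) hLip (η := (1 - lam) * (ε / 4)) (c := ε / 4)
      (fun w : Fin k → Fin M => dist_sifsMap_le hLip hD hB k w (hKB _ y hy))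
      (fun n hkn i x => (dist_comm _ _).trans_le (hN n (by lia) i x).le)
      (by positivity) (by linarith) m j
    rw [hk]
    linarith [dist_triangle (sifsMap f (k + m) (fun t => j t) y) (prefixComp flim j m x₀) p]
  obtain ⟨y₀, hy₀⟩ := hKne (j n)
  rw [Real.dist_0_eq_abs, abs_of_nonneg hausdorffDist_nonneg]
  refine (hausdorffDist_le_of_mem_dist (r := 3 * (ε / 4)) (by positivity) ?_ ?_).trans_lt
    (by linarith)
  · rintro _ ⟨y, hy, rfl⟩
    exact ⟨p, rfl, hclose y hy⟩
  · rintro _ rfl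
    exact ⟨_, ⟨y₀, hy₀, rfl⟩, (dist_comm _ _).trans_le (hclose y₀ hy₀)⟩
end

section
/- Let ((F_n), (K_i)) be an SIFS system with ratio λ on ℝ^q in which every map f_i^{(n)} is a homeomorphism of ℝ^q. Fix an infinite blowup address j = j_1 j_2 ⋯ ∈ {1,…,M}^ℕ and set g_k := f_{j_k}^{(k)} ∘ ⋯ ∘ f_{j_1}^{(1)}. Then for every k ≥ 1 and every word i_1…i_k ∈ {1,…,M}^k, the blown-up processed tiles are non-increasing: g_{k+1}^{-1}(π̃_T(j_{k+1} i_1 i_2 … i_k)) ⊆ g_k^{-1}(π̃_T(i_1 i_2 … i_k)), where g^{-1} denotes preimage. -/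
open Filter Metric Topology

/-- Lexicographic order on words of equal length with the convention that smaller indices
are larger: `w' ≻ w` iff at the first position where they differ, `w'` has the smaller
index. -/
def wordGT {M k : ℕ} (w' w : Fin k → Fin M) : Prop :=
  ∃ t : Fin k, (∀ s : Fin k, s < t → w' s = w s) ∧ w' t < w t

/-- The processed tile `π̃_T(w) = closure (π_T(w) \ ⋃_{w' ≻ w} π_T(w'))`. -/
def processedTile {E : Type*} [TopologicalSpace E] {M : ℕ}
    (f : ℕ → Fin M → E → E) (K : Fin M → Set E)
    (k : ℕ) (w : Fin (k + 1) → Fin M) : Set E :=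
  closure (piT f K k w \ ⋃ w' : Fin (k + 1) → Fin M, ⋃ _ : wordGT w' w, piT f K k w')

/-- The blowup composition `g_k = f^{(k)}_{j_k} ∘ ⋯ ∘ f^{(1)}_{j_1}` along an infinite
blowup address `j : ℕ → Fin M` (with `j 0 = j₁`). -/
def blowupComp {E : Type*} {M : ℕ} (f : ℕ → Fin M → E → E) (j : ℕ → Fin M) : ℕ → E → E
  | 0 => id
  | k + 1 => f (k + 1) (j k) ∘ blowupComp f j k

theorem piT_cons {E : Type*} {M : ℕ} (f : ℕ → Fin M → E → E) (K : Fin M → Set E)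
    (k : ℕ) (a : Fin M) (w : Fin (k + 1) → Fin M) :
    piT f K (k + 1) (Fin.cons a w) = f (k + 2) a '' piT f K k w := by
  simp only [piT, ← Set.image_comp]
  rfl

theorem wordGT.cons {M k : ℕ} {w' w : Fin k → Fin M} (h : wordGT w' w) (a : Fin M) :
    wordGT (Fin.cons a w' : Fin (k + 1) → Fin M) (Fin.cons a w) := by
  obtain ⟨t, ht, hlt⟩ := h
  refine ⟨t.succ, fun s => Fin.cases (fun _ => rfl) (fun i hi => ?_) s, by simpa using hlt⟩
  simpa using ht i (Fin.succ_lt_succ_iff.1 hi)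

theorem preimage_processedTile_cons_subset {E : Type*} [TopologicalSpace E] {M : ℕ}
    (f : ℕ → Fin M → E → E) (K : Fin M → Set E) (k : ℕ) (a : Fin M)
    (hf : IsHomeomorph (f (k + 2) a)) (w : Fin (k + 1) → Fin M) :
    f (k + 2) a ⁻¹' processedTile f K (k + 1) (Fin.cons a w) ⊆ processedTile f K k w := by
  unfold processedTile
  rw [hf.isOpenMap.preimage_closure_eq_closure_preimage hf.continuous]
  refine closure_mono ?_
  rintro x ⟨hx, hx'⟩
  rw [piT_cons, hf.injective.mem_set_image] at hx
  refine ⟨hx, fun hmem => hx' ?_⟩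
  simp only [Set.mem_iUnion] at hmem ⊢
  obtain ⟨w', hw', hxw'⟩ := hmem
  refine ⟨Fin.cons a w', hw'.cons a, ?_⟩
  rw [piT_cons]
  exact Set.mem_image_of_mem _ hxw'

/-- For an SIFS system whose maps are all homeomorphisms of `ℝ^q`, and a
blowup address `j`, the blown-up processed tiles are non-increasing: for every `k ≥ 1` and
every word `i₁ … i_k` (here of length `k + 1`, i.e. `w : Fin (k+1) → Fin M`),
`g_{k+2}⁻¹(π̃_T(j_{k+2} i₁ … i_{k+1})) ⊆ g_{k+1}⁻¹(π̃_T(i₁ … i_{k+1}))`. -/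
theorem sifs_system_processed_tiles_antitone
    (q M : ℕ) (hq : 1 ≤ q) (hM : 1 ≤ M)
    (lam : NNReal) (hlam0 : 0 < lam) (hlam1 : lam < 1)
    (f : ℕ → Fin M → EuclideanSpace ℝ (Fin q) → EuclideanSpace ℝ (Fin q))
    (flim : Fin M → EuclideanSpace ℝ (Fin q) → EuclideanSpace ℝ (Fin q))
    (hLip : ∀ n i, LipschitzWith lam (f n i))
    (hLipLim : ∀ i, LipschitzWith lam (flim i))
    (hconv : ∀ i, TendstoUniformly (fun n => f n i) (flim i) atTop)
    (hhomeo : ∀ n i, IsHomeomorph (f n i))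
    (K : Fin M → Set (EuclideanSpace ℝ (Fin q)))
    (hKne : ∀ i, (K i).Nonempty) (hKcp : ∀ i, IsCompact (K i))
    (j : ℕ → Fin M) :
    ∀ (k : ℕ) (w : Fin (k + 1) → Fin M),
      blowupComp f j (k + 2) ⁻¹' processedTile f K (k + 1) (Fin.cons (j (k + 1)) w) ⊆
        blowupComp f j (k + 1) ⁻¹' processedTile f K k w := by
  intro k w x hx
  exact preimage_processedTile_cons_subset f K k _ (hhomeo _ _) w hx
end

section
/- For every c ∈ ℝ, every i ∈ {1,…,7}, the translation vectors t_i^{(n)} of the hat SIFS converge in ℂ as n → ∞; consequently each map f_i^{(n)} converges uniformly on ℂ to an affine contraction with ratio φ, so the hat sequence (F_{n,c}) is a sequential IFS. In particular, t_7^{(n)} → (√3(1−c)+3c) + i(−3(1−c)+√3c)/√5. -/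
open Filter Metric Topology

/-- `φ = (3 − √5)/2`, the inverse square of the golden ratio. -/
noncomputable def hatPhi : ℝ := (3 - Real.sqrt 5) / 2

/-- The Fibonacci numbers as real numbers (`F₀ = 0`, `F₁ = F₂ = 1`). -/
noncomputable def fibR (m : ℕ) : ℝ := (Nat.fib m : ℝ)

/-- The translation vector `t_i⁽ⁿ⁾` of the `i`-th hat SIFS map at level `n`
(for `i ∈ {1,…,7}`; `t₁⁽ⁿ⁾ = 0`). -/
noncomputable def hatT (c : ℝ) (i n : ℕ) : ℂ :=
  match i with
  | 1 => 0
  | 2 => ((hatPhi ^ n * (Real.sqrt 3 * (1 - c) * (fibR (2 * n + 2) - 2)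
            + 3 * c * (fibR (2 * n - 1) - 1)) : ℝ) : ℂ)
       + Complex.I * ((hatPhi ^ n * (3 * (1 - c) * fibR (2 * n - 1)
            + Real.sqrt 3 * c * (2 * fibR (2 * n + 1) + fibR (2 * n - 1) - 1)) : ℝ) : ℂ)
  | 3 => ((hatPhi ^ n * (3 * Real.sqrt 3 * (1 - c) * (fibR (2 * n + 1) - 1)
            + 3 * c * (2 * fibR (2 * n - 1) + fibR (2 * n + 1) - 2)) : ℝ) : ℂ)
       + Complex.I * ((hatPhi ^ n * (-3 * (1 - c) * (fibR (2 * n - 2) - 1)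
            + 3 * Real.sqrt 3 * c * fibR (2 * n + 1)) : ℝ) : ℂ)
  | 4 => ((hatPhi ^ n * (2 * Real.sqrt 3 * (1 - c) * fibR (2 * n + 1)
            + 3 * c * (2 * fibR (2 * n + 2) - 1)) : ℝ) : ℂ)
       + Complex.I * ((hatPhi ^ n * (-6 * (1 - c) * (fibR (2 * n + 1) - 1)
            - Real.sqrt 3 * c * (2 * fibR (2 * n - 1) - 3)) : ℝ) : ℂ)
  | 5 => ((hatPhi ^ n * (Real.sqrt 3 * (1 - c) * (fibR (2 * n) + 1)
            + 9 * c * fibR (2 * n)) : ℝ) : ℂ)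
       + Complex.I * ((hatPhi ^ n * (-3 * (1 - c) * (fibR (2 * n - 1) + fibR (2 * n + 1) - 1)
            + Real.sqrt 3 * c * (2 - fibR (2 * n - 1) - fibR (2 * n + 1))) : ℝ) : ℂ)
  | 6 => ((hatPhi ^ n * (Real.sqrt 3 * (1 - c) + 3 * c)
            * (fibR (2 * n) + fibR (2 * n - 2)) : ℝ) : ℂ)
       + Complex.I * ((hatPhi ^ n * (-3 * (1 - c) + Real.sqrt 3 * c) * fibR (2 * n - 1) : ℝ) : ℂ)
  | 7 => ((hatPhi ^ n * (Real.sqrt 3 * (1 - c) + 3 * c)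
            * (fibR (2 * n + 1) + fibR (2 * n - 1)) : ℝ) : ℂ)
       + Complex.I * ((hatPhi ^ n * (-3 * (1 - c) + Real.sqrt 3 * c) * fibR (2 * n) : ℝ) : ℂ)
  | _ => 0

/-- The linear coefficient of the `i`-th hat SIFS map: `φ` times a sixth root of unity. -/
noncomputable def hatCoef (i : ℕ) : ℂ :=
  match i with
  | 1 => (hatPhi : ℂ)
  | 2 => (hatPhi : ℂ) * Complex.exp (-Complex.I * Real.pi / 3)
  | 3 => (hatPhi : ℂ) * Complex.exp (-2 * Complex.I * Real.pi / 3)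
  | 4 => (hatPhi : ℂ) * Complex.exp (2 * Complex.I * Real.pi / 3)
  | 5 => (hatPhi : ℂ) * Complex.exp (Complex.I * Real.pi / 3)
  | 6 => (hatPhi : ℂ)
  | 7 => (hatPhi : ℂ)
  | _ => 0

/-- The `i`-th hat SIFS map at level `n`: `f_i⁽ⁿ⁾(z) = hatCoef i · z + t_i⁽ⁿ⁾`. -/
noncomputable def hatF (c : ℝ) (i n : ℕ) (z : ℂ) : ℂ := hatCoef i * z + hatT c i n

theorem hatPhi_eq_goldenConj_sq : hatPhi = Real.goldenConj ^ 2 := by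
  rw [Real.goldenConj_sq, hatPhi, Real.goldenConj]
  ring

theorem hatPhi_nonneg : 0 ≤ hatPhi := by
  rw [hatPhi_eq_goldenConj_sq]
  positivity

theorem hatPhi_lt_one : hatPhi < 1 := by
  have h : (1 : ℝ) < Real.sqrt 5 := by
    rw [Real.lt_sqrt] <;> norm_num
  rw [hatPhi]
  linarith

theorem hatPhi_mul_goldenRatio_sq : hatPhi * Real.goldenRatio ^ 2 = 1 := by
  rw [hatPhi_eq_goldenConj_sq, ← mul_pow, Real.goldenConj_mul_goldenRatio]
  norm_num

theorem tendsto_hatPhi_pow : Tendsto (fun n : ℕ => hatPhi ^ n) atTop (𝓝 0) :=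
  tendsto_pow_atTop_nhds_zero_of_lt_one hatPhi_nonneg hatPhi_lt_one

theorem hatPhi_pow_mul_fibR (k n : ℕ) :
    hatPhi ^ n * fibR (2 * n + k) =
      (Real.goldenRatio ^ k - hatPhi ^ n * hatPhi ^ n * Real.goldenConj ^ k) / Real.sqrt 5 := by
  have h : hatPhi ^ n * (Real.goldenRatio ^ 2) ^ n = 1 := by
    rw [← mul_pow, hatPhi_mul_goldenRatio_sq, one_pow]
  rw [fibR, Real.coe_fib_eq, pow_add, pow_add, pow_mul, pow_mul, ← hatPhi_eq_goldenConj_sq]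
  linear_combination (Real.goldenRatio ^ k / Real.sqrt 5) * h

theorem tendsto_hatPhi_pow_mul_fibR (k : ℕ) :
    Tendsto (fun n : ℕ => hatPhi ^ n * fibR (2 * n + k)) atTop
      (𝓝 (Real.goldenRatio ^ k / Real.sqrt 5)) := by
  simp_rw [hatPhi_pow_mul_fibR]
  simpa using (((tendsto_hatPhi_pow.mul tendsto_hatPhi_pow).mul_const
    (Real.goldenConj ^ k)).const_sub (Real.goldenRatio ^ k)).div_const (Real.sqrt 5)

theorem tendsto_hatPhi_pow_mul_linear (x y z : ℝ) :
    Tendsto (fun n : ℕ => hatPhi ^ n * (x + y * fibR (2 * n) + z * fibR (2 * n + 1))) atTop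
      (𝓝 ((y + z * Real.goldenRatio) / Real.sqrt 5)) := by
  have h := ((tendsto_hatPhi_pow.const_mul x).add
    ((tendsto_hatPhi_pow_mul_fibR 0).const_mul y)).add
    ((tendsto_hatPhi_pow_mul_fibR 1).const_mul z)
  refine (h.congr fun n => ?_).trans_eq ?_
  · rw [add_zero]
    ring
  · congr 1
    ring

theorem fibR_two_mul_add_two (n : ℕ) : fibR (2 * n + 2) = fibR (2 * n) + fibR (2 * n + 1) := by
  simp only [fibR, Nat.fib_add_two, Nat.cast_add]

theorem fibR_two_mul_sub_one {n : ℕ} (hn : 1 ≤ n) :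
    fibR (2 * n - 1) = fibR (2 * n + 1) - fibR (2 * n) := by
  obtain ⟨m, rfl⟩ := Nat.exists_eq_add_of_le' hn
  have h : Nat.fib (2 * m + 3) = Nat.fib (2 * m + 1) + Nat.fib (2 * m + 2) := Nat.fib_add_two
  have h' : (Nat.fib (2 * m + 3) : ℝ) = Nat.fib (2 * m + 1) + Nat.fib (2 * m + 2) := by
    exact_mod_cast h
  rw [show 2 * (m + 1) - 1 = 2 * m + 1 by lia, show 2 * (m + 1) + 1 = 2 * m + 3 by lia,
    show 2 * (m + 1) = 2 * m + 2 by lia]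
  simp only [fibR]
  linarith

theorem fibR_two_mul_sub_two {n : ℕ} (hn : 1 ≤ n) :
    fibR (2 * n - 2) = 2 * fibR (2 * n) - fibR (2 * n + 1) := by
  have h := fibR_two_mul_sub_one hn
  obtain ⟨m, rfl⟩ := Nat.exists_eq_add_of_le' hn
  have h' := fibR_two_mul_add_two m
  rw [show 2 * (m + 1) - 1 = 2 * m + 1 by lia] at h
  rw [show 2 * m + 2 = 2 * (m + 1) by lia] at h'
  rw [show 2 * (m + 1) - 2 = 2 * m by lia]
  linarith

theorem tendsto_of_eq_hatPhi_pow_mul_linear {T : ℕ → ℂ} (x y z x' y' z' : ℝ)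
    (h : ∀ n, 1 ≤ n → T n =
      ((hatPhi ^ n * (x + y * fibR (2 * n) + z * fibR (2 * n + 1)) : ℝ) : ℂ) +
        Complex.I * ((hatPhi ^ n * (x' + y' * fibR (2 * n) + z' * fibR (2 * n + 1)) : ℝ) : ℂ)) :
    Tendsto T atTop (𝓝 ((((y + z * Real.goldenRatio) / Real.sqrt 5 : ℝ) : ℂ) +
      Complex.I * (((y' + z' * Real.goldenRatio) / Real.sqrt 5 : ℝ) : ℂ))) := by
  have h₁ := (Complex.continuous_ofReal.tendsto _).comp (tendsto_hatPhi_pow_mul_linear x y z)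
  have h₂ := (Complex.continuous_ofReal.tendsto _).comp (tendsto_hatPhi_pow_mul_linear x' y' z')
  refine (h₁.add (h₂.const_mul Complex.I)).congr' ?_
  filter_upwards [eventually_ge_atTop 1] with n hn
  exact (h n hn).symm

theorem tendsto_hatT_seven (c : ℝ) :
    Tendsto (fun n => hatT c 7 n) atTop
      (𝓝 (((Real.sqrt 3 * (1 - c) + 3 * c : ℝ) : ℂ) +
        Complex.I * (((-3 * (1 - c) + Real.sqrt 3 * c) / Real.sqrt 5 : ℝ) : ℂ))) := by
  set k := Real.sqrt 3 * (1 - c) + 3 * c with hk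
  set l := -3 * (1 - c) + Real.sqrt 3 * c with hl
  have h := tendsto_of_eq_hatPhi_pow_mul_linear (T := fun n => hatT c 7 n) 0 (-k) (2 * k) 0 l 0
    fun n hn => by
      simp only [hatT, fibR_two_mul_sub_one hn, ← hk, ← hl]
      push_cast
      ring
  have hre : (-k + 2 * k * Real.goldenRatio) / Real.sqrt 5 = k := by
    rw [Real.goldenRatio, div_eq_iff (by positivity)]
    ring
  rw [hre, zero_mul, add_zero] at h
  exact h

theorem exists_tendsto_hatT (c : ℝ) {i : ℕ} (h₁ : 1 ≤ i) (h₇ : i ≤ 7) :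
    ∃ L : ℂ, Tendsto (fun n => hatT c i n) atTop (𝓝 L) := by
  set s := Real.sqrt 3 with hs
  interval_cases i
  · exact ⟨0, tendsto_const_nhds⟩
  · refine ⟨_, tendsto_of_eq_hatPhi_pow_mul_linear
      (-2 * s * (1 - c) - 3 * c) (s * (1 - c) - 3 * c) (s * (1 - c) + 3 * c)
      (-s * c) (-3 * (1 - c) - s * c) (3 * (1 - c) + 3 * s * c) fun n hn => ?_⟩
    simp only [hatT, fibR_two_mul_add_two, fibR_two_mul_sub_one hn, ← hs]
    push_cast
    ring
  · refine ⟨_, tendsto_of_eq_hatPhi_pow_mul_linear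
      (-3 * s * (1 - c) - 6 * c) (-6 * c) (3 * s * (1 - c) + 9 * c)
      (3 * (1 - c)) (-6 * (1 - c)) (3 * (1 - c) + 3 * s * c) fun n hn => ?_⟩
    simp only [hatT, fibR_two_mul_sub_one hn, fibR_two_mul_sub_two hn, ← hs]
    push_cast
    ring
  · refine ⟨_, tendsto_of_eq_hatPhi_pow_mul_linear
      (-3 * c) (6 * c) (2 * s * (1 - c) + 6 * c)
      (6 * (1 - c) + 3 * s * c) (2 * s * c) (-6 * (1 - c) - 2 * s * c) fun n hn => ?_⟩
    simp only [hatT, fibR_two_mul_add_two, fibR_two_mul_sub_one hn, ← hs]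
    push_cast
    ring
  · refine ⟨_, tendsto_of_eq_hatPhi_pow_mul_linear
      (s * (1 - c)) (s * (1 - c) + 9 * c) 0
      (3 * (1 - c) + 2 * s * c) (3 * (1 - c) + s * c) (-6 * (1 - c) - 2 * s * c) fun n hn => ?_⟩
    simp only [hatT, fibR_two_mul_sub_one hn, ← hs]
    push_cast
    ring
  · refine ⟨_, tendsto_of_eq_hatPhi_pow_mul_linear
      0 (3 * (s * (1 - c) + 3 * c)) (-(s * (1 - c) + 3 * c))
      0 (-(-3 * (1 - c) + s * c)) (-3 * (1 - c) + s * c) fun n hn => ?_⟩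
    simp only [hatT, fibR_two_mul_sub_one hn, fibR_two_mul_sub_two hn, ← hs]
    push_cast
    ring
  · exact ⟨_, tendsto_hatT_seven c⟩

theorem norm_hatCoef {i : ℕ} (h₁ : 1 ≤ i) (h₇ : i ≤ 7) : ‖hatCoef i‖ = hatPhi := by
  interval_cases i <;>
    simp [hatCoef, Complex.norm_exp, abs_of_nonneg hatPhi_nonneg]

/-- For every `c ∈ ℝ` and every `i ∈ {1,…,7}`, the translation vectors
`t_i⁽ⁿ⁾` of the hat SIFS converge in `ℂ`; consequently each `f_i⁽ⁿ⁾` converges uniformly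
on `ℂ` to an affine contraction with ratio `φ`, so the hat sequence is a sequential IFS.
In particular `t₇⁽ⁿ⁾ → (√3(1−c)+3c) + i(−3(1−c)+√3c)/√5`. -/
theorem hat_sifs_convergence (c : ℝ) :
    (∀ i : ℕ, 1 ≤ i → i ≤ 7 → ∃ L : ℂ,
      Tendsto (fun n => hatT c i n) atTop (𝓝 L) ∧
      TendstoUniformly (fun n => hatF c i n) (fun z => hatCoef i * z + L) atTop ∧
      LipschitzWith hatPhi.toNNReal (fun z => hatCoef i * z + L)) ∧
    Tendsto (fun n => hatT c 7 n) atTop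
      (𝓝 (((Real.sqrt 3 * (1 - c) + 3 * c : ℝ) : ℂ) +
        Complex.I * (((-3 * (1 - c) + Real.sqrt 3 * c) / Real.sqrt 5 : ℝ) : ℂ))) := by
  refine ⟨fun i h₁ h₇ => ?_, tendsto_hatT_seven c⟩
  obtain ⟨L, hL⟩ := exists_tendsto_hatT c h₁ h₇
  refine ⟨L, hL, ?_, ?_⟩
  · rw [Metric.tendstoUniformly_iff]
    intro ε hε
    filter_upwards [Metric.tendsto_nhds.1 hL ε hε] with n hn z
    rwa [hatF, dist_add_left, dist_comm]
  · refine LipschitzWith.of_dist_le_mul fun z w => ?_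
    rw [dist_add_right, dist_eq_norm, ← mul_sub, norm_mul, norm_hatCoef h₁ h₇,
      Real.coe_toNNReal _ hatPhi_nonneg, dist_eq_norm]
end

section
/- For every c ∈ ℝ and every n ≥ 1, the hat SIFS maps satisfy the exact-overlap identity f_6^{(n+1)} ∘ f_7^{(n)} = f_7^{(n+1)} ∘ f_1^{(n)} as maps ℂ → ℂ; equivalently, φ·t_7^{(n)} + t_6^{(n+1)} = t_7^{(n+1)}. -/
open Filter Metric Topology

/-- The hat tile vertex `v₈ = 2(1−c)√3 + c(3 + 3√3 i)`. -/
noncomputable def hatV8 (c : ℝ) : ℂ :=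
  ((2 * (1 - c) * Real.sqrt 3 : ℝ) : ℂ) + (c : ℂ) * (3 + 3 * (Real.sqrt 3 : ℂ) * Complex.I)

/-- The closed-form intersection point
`p_n = φⁿ[ v₈ + (√3(1−c)+3c)(F_{2n+2}+F_{2n}−1) + i(−3(1−c)+√3c)(F_{2n+1}−1) ]`. -/
noncomputable def hatP (c : ℝ) (n : ℕ) : ℂ :=
  ((hatPhi ^ n : ℝ) : ℂ) * (hatV8 c
    + (((Real.sqrt 3 * (1 - c) + 3 * c) * (fibR (2 * n + 2) + fibR (2 * n) - 1) : ℝ) : ℂ)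
    + Complex.I * (((-3 * (1 - c) + Real.sqrt 3 * c) * (fibR (2 * n + 1) - 1) : ℝ) : ℂ))

/-- The closed-form intersection point
`q_n = φⁿ[ 2√3(1−c)F_{2n+1}+3c(2F_{2n+2}−1) + i(−6(1−c)(F_{2n+1}−1)−√3c(2F_{2n−1}−3)) ]`. -/
noncomputable def hatQ (c : ℝ) (n : ℕ) : ℂ :=
  ((hatPhi ^ n : ℝ) : ℂ) *
    (((2 * Real.sqrt 3 * (1 - c) * fibR (2 * n + 1) + 3 * c * (2 * fibR (2 * n + 2) - 1) : ℝ) : ℂ)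
    + Complex.I * (((-6 * (1 - c) * (fibR (2 * n + 1) - 1)
        - Real.sqrt 3 * c * (2 * fibR (2 * n - 1) - 3)) : ℝ) : ℂ))

theorem fibR_add_two (m : ℕ) : fibR (m + 2) = fibR m + fibR (m + 1) := by
  simp only [fibR, Nat.fib_add_two, Nat.cast_add]

/-- The translations satisfy `φ·t₇⁽ⁿ⁾ + t₆⁽ⁿ⁺¹⁾ = t₇⁽ⁿ⁺¹⁾`, by the Fibonacci recurrence. -/
theorem hatPhi_mul_hatT_seven_add_hatT_six (c : ℝ) (n : ℕ) (hn : 1 ≤ n) :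
    (hatPhi : ℂ) * hatT c 7 n + hatT c 6 (n + 1) = hatT c 7 (n + 1) := by
  obtain ⟨k, rfl⟩ := Nat.exists_eq_add_of_le' hn
  have h₁ : 2 * (k + 1 + 1) - 1 = 2 * k + 1 + 2 := by omega
  have h₂ : 2 * (k + 1 + 1) - 2 = 2 * k + 2 := by omega
  have h₃ : 2 * (k + 1) = 2 * k + 2 := by omega
  have h₄ : 2 * (k + 1 + 1) = 2 * k + 2 + 2 := by omega
  simp only [hatT, h₁, h₂]
  simp only [h₃, h₄, fibR_add_two]
  push_cast
  ring

/-- For every `c ∈ ℝ` and `n ≥ 1`, the hat SIFS maps satisfy the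
exact-overlap identity `f₆⁽ⁿ⁺¹⁾ ∘ f₇⁽ⁿ⁾ = f₇⁽ⁿ⁺¹⁾ ∘ f₁⁽ⁿ⁾`; equivalently
`φ·t₇⁽ⁿ⁾ + t₆⁽ⁿ⁺¹⁾ = t₇⁽ⁿ⁺¹⁾`. -/
theorem hat_exact_overlap (c : ℝ) (n : ℕ) (hn : 1 ≤ n) :
    (∀ z : ℂ, hatF c 6 (n + 1) (hatF c 7 n z) = hatF c 7 (n + 1) (hatF c 1 n z)) ∧
    (hatPhi : ℂ) * hatT c 7 n + hatT c 6 (n + 1) = hatT c 7 (n + 1) := by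
  have key := hatPhi_mul_hatT_seven_add_hatT_six c n hn
  refine ⟨fun z => ?_, key⟩
  simp only [hatF, hatCoef]
  rw [← key]
  simp only [hatT]
  ring
end

section
/- For every c ∈ ℝ and every n ≥ 1, the n-fold composition of the hat maps f_7 applied to the vertex v_8 = 2(1−c)√3 + c(3+3√3 i) admits the closed form (f_7^{(n)} ∘ f_7^{(n−1)} ∘ ⋯ ∘ f_7^{(1)})(v_8) = p_n, where p_n := φ^n[ v_8 + (√3(1−c)+3c)(F_{2n+2}+F_{2n}−1) + i(−3(1−c)+√3c)(F_{2n+1}−1) ]. -/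
open Filter Metric Topology

/-- The `n`-fold composition `f₇⁽ⁿ⁾ ∘ f₇⁽ⁿ⁻¹⁾ ∘ ⋯ ∘ f₇⁽¹⁾`. -/
noncomputable def hatF7Iter (c : ℝ) : ℕ → ℂ → ℂ
  | 0 => id
  | n + 1 => hatF c 7 (n + 1) ∘ hatF7Iter c n

theorem hatP_zero (c : ℝ) : hatP c 0 = hatV8 c := by
  simp [hatP, fibR]

theorem hatF_seven_hatP (c : ℝ) (n : ℕ) : hatF c 7 (n + 1) (hatP c n) = hatP c (n + 1) := by
  simp only [hatF, hatCoef, hatT, hatP, mul_add, mul_one, fibR_add_two,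
    show 2 * n + 2 + 1 = 2 * n + 1 + 2 from rfl, show 2 * n + 1 + 1 = 2 * n + 2 from rfl]
  push_cast
  ring

theorem hatF7Iter_hatV8 (c : ℝ) (n : ℕ) : hatF7Iter c n (hatV8 c) = hatP c n := by
  induction n with
  | zero => exact (hatP_zero c).symm
  | succ n ih => rw [hatF7Iter, Function.comp_apply, ih, hatF_seven_hatP]

/-- For every `c ∈ ℝ` and `n ≥ 1`,
`(f₇⁽ⁿ⁾ ∘ f₇⁽ⁿ⁻¹⁾ ∘ ⋯ ∘ f₇⁽¹⁾)(v₈) = p_n`. -/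
theorem hat_p_closed_form (c : ℝ) (n : ℕ) (hn : 1 ≤ n) :
    hatF7Iter c n (hatV8 c) = hatP c n := by
  exact hatF7Iter_hatV8 c n
end

section
/- For every c ∈ ℝ and every n ≥ 1, the translation vectors of the hat maps f_6 and f_7 satisfy the recursion t_7^{(n+1)} = t_6^{(n+1)} + φ·p_n − φ²·p_{n−1}, where p_n is the closed-form intersection point p_n = φ^n[ v_8 + (√3(1−c)+3c)(F_{2n+2}+F_{2n}−1) + i(−3(1−c)+√3c)(F_{2n+1}−1) ] with v_8 = 2(1−c)√3 + c(3+3√3 i). -/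
open Filter Metric Topology

/-- For every `c ∈ ℝ` and `n ≥ 1`, the translation vectors of the hat
maps `f₆` and `f₇` satisfy the recursion `t₇⁽ⁿ⁺¹⁾ = t₆⁽ⁿ⁺¹⁾ + φ·p_n − φ²·p_{n−1}`. -/
theorem hat_t7_recursion (c : ℝ) (n : ℕ) (hn : 1 ≤ n) :
    hatT c 7 (n + 1) = hatT c 6 (n + 1) + (hatPhi : ℂ) * hatP c n
      - (hatPhi : ℂ) ^ 2 * hatP c (n - 1) := by
  obtain ⟨k, rfl⟩ := Nat.exists_eq_add_of_le' hn
  have h7 : hatT c 7 (k + 1 + 1) = ((hatPhi ^ (k + 2) * (Real.sqrt 3 * (1 - c) + 3 * c)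
      * (fibR (2 * k + 5) + fibR (2 * k + 3)) : ℝ) : ℂ)
      + Complex.I * ((hatPhi ^ (k + 2) * (-3 * (1 - c) + Real.sqrt 3 * c)
        * fibR (2 * k + 4) : ℝ) : ℂ) := rfl
  have h6 : hatT c 6 (k + 1 + 1) = ((hatPhi ^ (k + 2) * (Real.sqrt 3 * (1 - c) + 3 * c)
      * (fibR (2 * k + 4) + fibR (2 * k + 2)) : ℝ) : ℂ)
      + Complex.I * ((hatPhi ^ (k + 2) * (-3 * (1 - c) + Real.sqrt 3 * c)
        * fibR (2 * k + 3) : ℝ) : ℂ) := rfl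
  rw [h7, h6, Nat.add_sub_cancel]
  simp only [hatP, show 2 * (k + 1) = 2 * k + 2 by ring, add_assoc, Nat.reduceAdd]
  rw [show fibR (2 * k + 5) = fibR (2 * k + 3) + fibR (2 * k + 4) from fibR_add_two (2 * k + 3),
    show fibR (2 * k + 4) = fibR (2 * k + 2) + fibR (2 * k + 3) from fibR_add_two (2 * k + 2),
    show fibR (2 * k + 3) = fibR (2 * k + 1) + fibR (2 * k + 2) from fibR_add_two (2 * k + 1)]
  simp only [fibR_add_two (2 * k)]
  push_cast
  ring
end

section
/- For every c ∈ ℝ and every n ≥ 1, the hat tiling intersection identity f_4^{(n+1)}(p_n) = f_5^{(n+1)}(q_n) holds, i.e. φe^{2iπ/3}·p_n + t_4^{(n+1)} = φe^{iπ/3}·q_n + t_5^{(n+1)}, where p_n and q_n are the closed-form intersection points of the hat supertiles. -/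
open Filter Metric Topology

theorem exp_I_mul_pi_div_three :
    Complex.exp (Complex.I * Real.pi / 3) = 1 / 2 + (Real.sqrt 3 : ℂ) / 2 * Complex.I := by
  have h : Complex.I * Real.pi / 3 = ((Real.pi / 3 : ℝ) : ℂ) * Complex.I := by
    push_cast
    ring
  rw [h, Complex.exp_mul_I, ← Complex.ofReal_cos, ← Complex.ofReal_sin, Real.cos_pi_div_three,
    Real.sin_pi_div_three]
  push_cast
  ring

theorem exp_two_mul_I_mul_pi_div_three :
    Complex.exp (2 * Complex.I * Real.pi / 3) =
      -1 / 2 + (Real.sqrt 3 : ℂ) / 2 * Complex.I := by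
  have h : 2 * Complex.I * Real.pi / 3 =
      Complex.I * Real.pi / 3 + Complex.I * Real.pi / 3 := by ring
  have hs : (Real.sqrt 3 : ℂ) ^ 2 = 3 := by
    exact_mod_cast Real.sq_sqrt (show (0 : ℝ) ≤ 3 by norm_num)
  rw [h, Complex.exp_add, exp_I_mul_pi_div_three]
  linear_combination (Real.sqrt 3 : ℂ) ^ 2 / 4 * Complex.I_sq - hs / 4

/-- For every `c ∈ ℝ` and `n ≥ 1`, `f₄⁽ⁿ⁺¹⁾(p_n) = f₅⁽ⁿ⁺¹⁾(q_n)`, i.e.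
`φe^{2iπ/3}·p_n + t₄⁽ⁿ⁺¹⁾ = φe^{iπ/3}·q_n + t₅⁽ⁿ⁺¹⁾`. -/
theorem hat_intersection_f4_p_eq_f5_q (c : ℝ) (n : ℕ) (hn : 1 ≤ n) :
    hatF c 4 (n + 1) (hatP c n) = hatF c 5 (n + 1) (hatQ c n) := by
  have hs : (Real.sqrt 3) ^ 2 = 3 := Real.sq_sqrt (by norm_num)
  have h₁ : fibR (2 * n + 1) = fibR (2 * n - 1) + fibR (2 * n) := by
    have h := fibR_add_two (2 * n - 1)
    rwa [show 2 * n - 1 + 2 = 2 * n + 1 by omega, show 2 * n - 1 + 1 = 2 * n by omega] at h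
  have h₂ : fibR (2 * n + 2) = fibR (2 * n) + fibR (2 * n + 1) := fibR_add_two _
  have h₃ : fibR (2 * (n + 1) + 1) = fibR (2 * n + 1) + fibR (2 * n + 2) :=
    fibR_add_two (2 * n + 1)
  have h₄ : fibR (2 * (n + 1) + 2) = fibR (2 * n + 2) + fibR (2 * (n + 1) + 1) :=
    fibR_add_two (2 * n + 2)
  have h₅ : fibR (2 * (n + 1) - 1) = fibR (2 * n + 1) := rfl
  have h₆ : fibR (2 * (n + 1)) = fibR (2 * n + 2) := rfl
  simp only [hatF, hatCoef, hatT, hatP, hatQ, hatV8, exp_I_mul_pi_div_three,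
    exp_two_mul_I_mul_pi_div_three]
  rw [h₄, h₃, h₅, h₆, h₂, h₁, pow_succ hatPhi n]
  generalize fibR (2 * n - 1) = a
  generalize fibR (2 * n) = b
  generalize hatPhi ^ n = x
  generalize hatPhi = y
  generalize Real.sqrt 3 = s at hs ⊢
  apply Complex.ext
  · simp
    ring_nf
    simp only [hs]
    ring_nf
  · simp
    ring_nf
    simp only [hs]
    ring_nf
end

section
/- For every c ∈ ℝ and every n ≥ 1, the hat tiling intersection identity f_2^{(n+1)}(p_n) = f_3^{(n+1)}(q_n) holds, i.e. φe^{−iπ/3}·p_n + t_2^{(n+1)} = φe^{−2iπ/3}·q_n + t_3^{(n+1)}, where p_n and q_n are the closed-form intersection points of the hat supertiles. -/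
open Filter Metric Topology

theorem exp_neg_I_mul_pi_div_three :
    Complex.exp (-Complex.I * Real.pi / 3) = ((1 / 2 : ℝ) : ℂ) - (√3 / 2 : ℝ) * Complex.I := by
  have h : -Complex.I * Real.pi / 3 = ((-(Real.pi / 3) : ℝ) : ℂ) * Complex.I := by
    push_cast; ring
  rw [h, Complex.exp_mul_I, ← Complex.ofReal_cos, ← Complex.ofReal_sin, Real.cos_neg,
    Real.sin_neg, Real.cos_pi_div_three, Real.sin_pi_div_three]
  push_cast; ring

theorem exp_neg_two_mul_I_mul_pi_div_three :
    Complex.exp (-2 * Complex.I * Real.pi / 3) =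
      ((-(1 / 2) : ℝ) : ℂ) - (√3 / 2 : ℝ) * Complex.I := by
  have h : -2 * Complex.I * Real.pi / 3 =
      -Complex.I * Real.pi / 3 + -Complex.I * Real.pi / 3 := by ring
  have h3 : √3 * √3 = 3 := Real.mul_self_sqrt (by norm_num)
  rw [h, Complex.exp_add, exp_neg_I_mul_pi_div_three]
  apply Complex.ext <;> simp <;> linarith

/-- For every `c ∈ ℝ` and `n ≥ 1`, `f₂⁽ⁿ⁺¹⁾(p_n) = f₃⁽ⁿ⁺¹⁾(q_n)`, i.e.
`φe^{−iπ/3}·p_n + t₂⁽ⁿ⁺¹⁾ = φe^{−2iπ/3}·q_n + t₃⁽ⁿ⁺¹⁾`. -/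
theorem hat_intersection_f2_p_eq_f3_q (c : ℝ) (n : ℕ) (hn : 1 ≤ n) :
    hatF c 2 (n + 1) (hatP c n) = hatF c 3 (n + 1) (hatQ c n) := by
  obtain ⟨m, rfl⟩ : ∃ m, n = m + 1 := ⟨n - 1, by omega⟩
  have e₁ : 2 * m + 2 - 1 = 2 * m + 1 := by omega
  have e₂ : 2 * (m + 1 + 1) - 1 = 2 * m + 1 + 2 := by omega
  have e₃ : 2 * (m + 1 + 1) - 2 = 2 * m + 2 := by omega
  have e₄ : 2 * (m + 1 + 1) + 1 = 2 * m + 1 + 2 + 2 := by omega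
  have e₅ : 2 * (m + 1 + 1) + 2 = 2 * m + 2 + 2 + 2 := by omega
  have e₆ : 2 * m + 2 + 1 = 2 * m + 1 + 2 := by omega
  have e₇ : 2 * (m + 1) = 2 * m + 2 := by omega
  have h3 : √3 ^ 2 = 3 := Real.sq_sqrt (by norm_num)
  simp only [hatF, hatCoef, hatT, hatP, hatQ, hatV8, exp_neg_I_mul_pi_div_three,
    exp_neg_two_mul_I_mul_pi_div_three, e₁, e₂, e₃, e₄, e₅, e₆, e₇]
  have f₁ := fibR_add_two (2 * m + 1)
  have f₂ := fibR_add_two (2 * m + 2)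
  have f₃ := fibR_add_two (2 * m + 1 + 2)
  have f₄ := fibR_add_two (2 * m + 2 + 2)
  rw [show 2 * m + 1 + 1 = 2 * m + 2 by ring] at f₁
  rw [e₆] at f₂
  rw [show 2 * m + 1 + 2 + 1 = 2 * m + 2 + 2 by ring] at f₃
  rw [show 2 * m + 2 + 2 + 1 = 2 * m + 1 + 2 + 2 by ring] at f₄
  rw [f₄, f₃, f₂, f₁]
  generalize fibR (2 * m + 1) = a
  generalize fibR (2 * m + 2) = b
  rw [pow_succ hatPhi (m + 1)]
  generalize hatPhi ^ (m + 1) = P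
  have h3c : (√3 : ℂ) ^ 2 = 3 := by exact_mod_cast h3
  push_cast
  grind [Complex.I_sq]
end
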